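/- (Global Lipschitz continuity of the entropy-of-softmax objective.) Let C be a finite nonempty index type with n elements. The function u ↦ H(σ(u)) is Lipschitz on all of C → ℝ, with respect to the Euclidean norm, with Lipschitz constant 2·log n: for all u, v : C → ℝ, |H(σ(u)) − H(σ(v))| ≤ 2·(log n)·‖u − v‖. -/

import Mathlib

open Real Finset

/-- Softmax: `σ(u) c = exp (u c) / ∑ j, exp (u j)`. -/
noncomputable def softmax {C : Type*} [Fintype C] (u : C → ℝ) : C → ℝ :=
  fun c => Real.exp (u c) / ∑ j, Real.exp (u j)

/-- Shannon entropy `H(p) = −∑ c, p c * log (p c)` (natural log, `0 * log 0 = 0`). -/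
noncomputable def entropy {C : Type*} [Fintype C] (p : C → ℝ) : ℝ :=
  -∑ c, p c * Real.log (p c)

section Softmax

variable {C : Type*} [Fintype C]

theorem softmax_nonneg (u : C → ℝ) (c : C) : 0 ≤ softmax u c := by
  unfold softmax
  positivity

variable [Nonempty C]

theorem sum_exp_pos (u : C → ℝ) : 0 < ∑ c, exp (u c) :=
  sum_pos (fun c _ => exp_pos (u c)) univ_nonempty

theorem softmax_pos (u : C → ℝ) (c : C) : 0 < softmax u c :=
  div_pos (exp_pos _) (sum_exp_pos u)

theorem sum_softmax (u : C → ℝ) : ∑ c, softmax u c = 1 := by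
  simp only [softmax]
  rw [← sum_div, div_self (sum_exp_pos u).ne']

theorem log_softmax (u : C → ℝ) (c : C) :
    log (softmax u c) = u c - log (∑ j, exp (u j)) := by
  rw [softmax, log_div (exp_pos _).ne' (sum_exp_pos u).ne', log_exp]

theorem softmax_le_one (u : C → ℝ) (c : C) : softmax u c ≤ 1 :=
  (single_le_sum (fun i _ => softmax_nonneg u i) (mem_univ c)).trans_eq (sum_softmax u)

theorem entropy_softmax_eq (u : C → ℝ) :
    entropy (softmax u) =
      log (∑ j, exp (u j)) - (∑ c, u c * exp (u c)) / ∑ j, exp (u j) := by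
  have h : ∑ c, softmax u c * u c = (∑ c, u c * exp (u c)) / ∑ j, exp (u j) := by
    rw [sum_div]
    exact sum_congr rfl fun c _ => by rw [softmax]; ring
  simp only [entropy, log_softmax, mul_sub, sum_sub_distrib, ← sum_mul, sum_softmax, h]
  ring

theorem entropy_softmax_nonneg (u : C → ℝ) : 0 ≤ entropy (softmax u) :=
  neg_nonneg.2 <| sum_nonpos fun c _ => mul_nonpos_of_nonneg_of_nonpos (softmax_nonneg u c)
    (log_nonpos (softmax_nonneg u c) (softmax_le_one u c))

theorem entropy_softmax_le_log_card (u : C → ℝ) :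
    entropy (softmax u) ≤ log (Fintype.card C) := by
  have hn : (0 : ℝ) < Fintype.card C := by exact_mod_cast Fintype.card_pos
  have key (c : C) : -(softmax u c * log (softmax u c)) ≤
      (Fintype.card C : ℝ)⁻¹ - softmax u c + softmax u c * log (Fintype.card C) := by
    have hp := softmax_pos u c
    have h := log_le_sub_one_of_pos (inv_pos.2 (mul_pos hn hp))
    rw [log_inv, log_mul hn.ne' hp.ne'] at h
    have h' := mul_le_mul_of_nonneg_left h hp.le
    have e : softmax u c * ((Fintype.card C * softmax u c)⁻¹ - 1) =
        (Fintype.card C : ℝ)⁻¹ - softmax u c := by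
      field_simp
    linarith
  rw [entropy, ← sum_neg_distrib]
  refine (sum_le_sum fun c _ => key c).trans_eq ?_
  rw [sum_add_distrib, sum_sub_distrib, ← sum_mul, sum_softmax, sum_const, card_univ,
    nsmul_eq_mul, mul_inv_cancel₀ hn.ne']
  ring

theorem hasDerivAt_entropy_softmax_line (v w : C → ℝ) (t : ℝ) :
    HasDerivAt (fun s : ℝ => entropy (softmax fun c => v c + s * w c))
      (-∑ c, softmax (fun c => v c + t * w c) c *
        (log (softmax (fun c => v c + t * w c) c) +
          entropy (softmax fun c => v c + t * w c)) * w c) t := by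
  have hx (c : C) : HasDerivAt (fun s : ℝ => v c + s * w c) (w c) t := by
    simpa using ((hasDerivAt_id t).mul_const (w c)).const_add (v c)
  have hZ := HasDerivAt.fun_sum fun c (_ : c ∈ univ) => (hx c).exp
  have hN := HasDerivAt.fun_sum fun c (_ : c ∈ univ) => (hx c).fun_mul (hx c).exp
  have hpos := sum_exp_pos fun c => v c + t * w c
  have hd := (hZ.log hpos.ne').fun_sub (hN.fun_div hZ hpos.ne')
  simp only [entropy_softmax_eq, log_softmax]
  refine hd.congr_deriv (Eq.symm ?_)
  simp only [softmax]
  have e (Z N : ℝ) (hZ : 0 < Z) :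
      ∑ c, exp (v c + t * w c) / Z * (v c + t * w c - log Z + (log Z - N / Z)) * w c =
        (∑ c, (v c + t * w c) * (exp (v c + t * w c) * w c)) / Z -
          N / Z ^ 2 * ∑ c, exp (v c + t * w c) * w c := by
    rw [sum_div, mul_sum, ← sum_sub_distrib]
    refine sum_congr rfl fun c _ => ?_
    field_simp
    ring
  have e' : ∑ c, w c * exp (v c + t * w c) = ∑ c, exp (v c + t * w c) * w c :=
    sum_congr rfl fun c _ => mul_comm _ _
  rw [e _ _ hpos, sum_add_distrib, e']
  field_simp
  ring

theorem abs_sum_softmax_mul_log_add_entropy_le (u w : C → ℝ) {b : ℝ} (hw : ∀ c, |w c| ≤ b) :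
    |∑ c, softmax u c * (log (softmax u c) + entropy (softmax u)) * w c| ≤
      2 * log (Fintype.card C) * b := by
  have hb : 0 ≤ b := (abs_nonneg _).trans (hw (Classical.arbitrary C))
  have hH := entropy_softmax_nonneg u
  calc _ ≤ ∑ c, |softmax u c * (log (softmax u c) + entropy (softmax u)) * w c| :=
        abs_sum_le_sum_abs _ _
    _ ≤ ∑ c, (-(softmax u c * log (softmax u c)) + softmax u c * entropy (softmax u)) * b := by
        refine sum_le_sum fun c _ => ?_
        have hp := softmax_nonneg u c
        have hl := log_nonpos hp (softmax_le_one u c)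
        have ha : |log (softmax u c) + entropy (softmax u)| ≤
            -log (softmax u c) + entropy (softmax u) := by
          rw [abs_le]; constructor <;> linarith
        rw [abs_mul, abs_mul, abs_of_nonneg hp]
        calc _ ≤ softmax u c * (-log (softmax u c) + entropy (softmax u)) * b := by
              have := mul_nonneg hp ((abs_nonneg _).trans ha)
              gcongr
              exact hw c
          _ = _ := by ring
    _ = 2 * entropy (softmax u) * b := by
        rw [← sum_mul, sum_add_distrib, ← sum_mul, sum_softmax, sum_neg_distrib, ← entropy]
        ring
    _ ≤ _ := by
        gcongr
        exact entropy_softmax_le_log_card u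

theorem abs_entropy_softmax_sub_le (u v : C → ℝ) {b : ℝ} (h : ∀ c, |u c - v c| ≤ b) :
    |entropy (softmax u) - entropy (softmax v)| ≤ 2 * log (Fintype.card C) * b := by
  have := convex_univ.norm_image_sub_le_of_norm_hasDerivWithin_le
    (f := fun s : ℝ => entropy (softmax fun c => v c + s * (u c - v c)))
    (fun t _ => (hasDerivAt_entropy_softmax_line v (fun c => u c - v c) t).hasDerivWithinAt)
    (fun t _ => by
      rw [norm_neg]
      exact abs_sum_softmax_mul_log_add_entropy_le _ _ h)
    (Set.mem_univ 0) (Set.mem_univ 1)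
  simpa using this

end Softmax

/-- (Global Lipschitz continuity of the entropy-of-softmax objective.)
For all `u, v : C → ℝ` (Euclidean norm, `n` classes),
`|H(σ(u)) − H(σ(v))| ≤ 2·(log n)·‖u − v‖`. -/
theorem entropy_softmax_global_lipschitz {C : Type*} [Fintype C] [Nonempty C]
    (n : ℕ) (hn : Fintype.card C = n)
    (u v : EuclideanSpace ℝ C) :
    |entropy (softmax u) - entropy (softmax v)| ≤ 2 * Real.log n * ‖u - v‖ := by
  subst hn
  exact abs_entropy_softmax_sub_le u v fun c => PiLp.norm_apply_le (u - v) c
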